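/- Bounds for the lucky counting function: let x ≥ 1 be real and let R(i,x) = #{k ∈ A_{i-1} : k ≤ x}. For every m ≥ 1 such that l_{m+1} > R(m+1,x), one has ⌊x⌋·∏_{i=1}^{m}(1 − 1/l_i) ≤ L(x) < ⌊x⌋·∏_{i=1}^{m}(1 − 1/l_i) + m. -/

import Mathlib

open scoped BigOperators

namespace LuckyPaper

/-- Rank of `k` in `A`: the number of elements of `A` that are `≤ k`
(the 1-indexed position of `k` in `A` when `k ∈ A`). -/
noncomputable def rank (A : Set ℕ) (k : ℕ) : ℕ := Set.ncard {m | m ∈ A ∧ m ≤ k}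

/-- One sieve step: delete every `d`-th element of `A` (listed in increasing order). -/
noncomputable def step (A : Set ℕ) (d : ℕ) : Set ℕ := {k | k ∈ A ∧ ¬ d ∣ rank A k}

/-- The lucky sieve: `sieve i = (A_i, l_i)`, where `A_0 = {1,2,3,…}`, `l_0 = 1` (dummy),
`l_{i+1}` is the smallest element of `A_i` larger than `l_i`, and `A_{i+1}` is obtained
from `A_i` by deleting every `l_{i+1}`-th element.  In particular `l_1 = 2`. -/
noncomputable def sieve : ℕ → Set ℕ × ℕ
  | 0 => ({n | 1 ≤ n}, 1)
  | i + 1 =>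
      let p := sieve i
      let d := sInf {m | m ∈ p.1 ∧ p.2 < m}
      (step p.1 d, d)

/-- `A i` : the set of survivors after `i` steps of the lucky sieve. -/
noncomputable def A (i : ℕ) : Set ℕ := (sieve i).1

/-- `l i` : the `i`-th sieve parameter (`l 1 = 2`, `l 2 = 3`, `l 3 = 7`, `l 4 = 9`, …);
with this convention `l n` is the `n`-th lucky number for `n ≥ 2`. -/
noncomputable def l (i : ℕ) : ℕ := (sieve i).2

/-- The set of lucky numbers `A_∞ = ⋂ i, A i = {1, 3, 7, 9, 13, 15, 21, 25, …}`. -/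
noncomputable def LuckySet : Set ℕ := ⋂ i, A i

/-- `L x` : the number of lucky numbers that are `≤ x`. -/
noncomputable def L (x : ℝ) : ℕ := Set.ncard {m | m ∈ LuckySet ∧ (m : ℝ) ≤ x}

/-- `R i x = #{k ∈ A_{i-1} : k ≤ x}`. -/
noncomputable def R (i : ℕ) (x : ℝ) : ℕ := Set.ncard {m | m ∈ A (i - 1) ∧ (m : ℝ) ≤ x}

/-- `𝕃 = {l 1, l 2, l 3, …} = {2, 3, 7, 9, 13, …}`. -/
noncomputable def Ell : Set ℕ := {a | ∃ i, 1 ≤ i ∧ l i = a}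

/-- `starIdx i m` : the `m`-th number deleted at step `i` of the sieve, i.e. the
`(l i * m)`-th smallest element of `A (i-1)` (`Nat.nth` is 0-indexed). -/
noncomputable def starIdx (i m : ℕ) : ℕ := Nat.nth (· ∈ A (i - 1)) (l i * m - 1)

/-- The binary operation `*` : for `a ∈ 𝕃`, `star a m = a * m` is the `m`-th number
deleted at the (unique) step `i ≥ 1` with `l i = a`. -/
noncomputable def star (a m : ℕ) : ℕ := starIdx (sInf {i | 1 ≤ i ∧ l i = a}) m

/-- `evalStar [a₁, …, a_k] = a₁ * (a₂ * (⋯ * a_k)⋯)`. -/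
noncomputable def evalStar : List ℕ → ℕ
  | [] => 1
  | [a] => a
  | a :: b :: rest => star a (evalStar (b :: rest))

/-- `t = (a₁, …, a_k)` is a lucky factorization of `n` : `k ≥ 1`, `a_j ∈ 𝕃` for `j < k`,
`a_k` is a lucky number (possibly 1), and `n = a₁*(a₂*(⋯*a_k)⋯)`. -/
def IsLuckyFactorization (n : ℕ) (t : List ℕ) : Prop :=
  t ≠ [] ∧ (∀ a ∈ t.dropLast, a ∈ Ell) ∧ t.getLast! ∈ LuckySet ∧ evalStar t = n

/-- The canonical tuple of `n` given by the fundamental theorem of arithmetic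
for lucky numbers. -/
noncomputable def canonicalTuple (n : ℕ) : List ℕ :=
  haveI := Classical.propDecidable (∃ t, IsLuckyFactorization n t)
  if h : ∃ t, IsLuckyFactorization n t then h.choose else []

/-- `Ω°(n)` : the length of the canonical tuple of `n`. -/
noncomputable def bigOmega (n : ℕ) : ℕ := (canonicalTuple n).length

/-- `ω°(n)` : the number of distinct entries of the canonical tuple of `n`. -/
noncomputable def smallOmega (n : ℕ) : ℕ := (canonicalTuple n).dedup.length

/-- `d°(n)` : the number of distinct nonempty contiguous subtuples (infixes) of the
canonical tuple of `n`. -/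
noncomputable def dCirc (n : ℕ) : ℕ :=
  Set.ncard {s : List ℕ | s ≠ [] ∧ s <:+: canonicalTuple n}

/-- `B` : positive integers whose canonical tuple has last entry `≠ 1`. -/
noncomputable def Bset : Set ℕ := {n | 1 ≤ n ∧ (canonicalTuple n).getLast! ≠ 1}

/-- `C` : positive integers whose canonical tuple ends with the pair `(2, 1)`. -/
noncomputable def Cset : Set ℕ := {n | 1 ≤ n ∧ ∃ t, canonicalTuple n = t ++ [2, 1]}

/-- `S = B ∪ C`. -/
noncomputable def Sset : Set ℕ := Bset ∪ Cset

/-- The `𝕃`-tuple of `a ∈ S` : the canonical tuple of `a` if it does not end in `1`,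
else the canonical tuple with the final `1` removed (so it ends in `2`). -/
noncomputable def ellTuple (a : ℕ) : List ℕ :=
  if (canonicalTuple a).getLast! = 1 then (canonicalTuple a).dropLast else canonicalTuple a

/-- The extended operation `∘` : if the `𝕃`-tuple of `a` is `(t₁, …, t_k)`, then
`a ∘ b = t₁*(t₂*(⋯*(t_k*b)⋯))`. -/
noncomputable def circ (a b : ℕ) : ℕ := (ellTuple a).foldr star b


open scoped Classical in
theorem rank_eq_count (A : Set ℕ) (k : ℕ) : rank A k = Nat.count (· ∈ A) (k + 1) := by
  rw [rank, Nat.count_eq_card_filter_range, ← Set.ncard_coe_finset]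
  congr 1
  ext n
  simp [and_comm]

theorem rank_le_rank_of_subset {A B : Set ℕ} (hAB : A ⊆ B) {j k : ℕ} (hjk : j ≤ k) :
    rank A j ≤ rank B k :=
  Set.ncard_le_ncard (fun _ hn => ⟨hAB hn.1, hn.2.trans hjk⟩)
    ((Set.finite_Iic k).subset fun _ hn => hn.2)

theorem rank_pos {A : Set ℕ} {k : ℕ} (hk : k ∈ A) : 0 < rank A k :=
  (Set.ncard_pos ((Set.finite_Iic k).subset fun _ hn => hn.2)).2 ⟨k, hk, le_rfl⟩

open scoped Classical in
theorem count_step_add (A : Set ℕ) (d n : ℕ) :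
    Nat.count (· ∈ step A d) n + Nat.count (· ∈ A) n / d = Nat.count (· ∈ A) n := by
  induction n with
  | zero => simp
  | succ n ih =>
    have hr := rank_eq_count A n
    rw [Nat.count_succ] at hr
    rw [Nat.count_succ, Nat.count_succ]
    by_cases hA : n ∈ A
    · simp only [hA, if_true] at hr ⊢
      by_cases hd : d ∣ rank A n
      · have hn : n ∉ step A d := fun hn => hn.2 hd
        rw [hr] at hd
        simp only [hn, if_false, Nat.succ_div, hd, if_true]
        omega
      · have hn : n ∈ step A d := ⟨hA, hd⟩
        rw [hr] at hd
        simp only [hn, if_true, Nat.succ_div, hd, if_false]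
        omega
    · have hn : n ∉ step A d := fun hn => hA hn.1
      simpa [hA, hn] using ih

theorem rank_step_add (A : Set ℕ) (d k : ℕ) :
    rank (step A d) k + rank A k / d = rank A k := by
  classical
  simpa only [rank_eq_count] using count_step_add A d (k + 1)

theorem infinite_step {A : Set ℕ} (hA : A.Infinite) {d : ℕ} (hd : 2 ≤ d) :
    (step A d).Infinite := by
  classical
  intro hfin
  set K := (step A d).ncard
  set n := Nat.nth (· ∈ A) (2 * K + 2)
  have hc : Nat.count (· ∈ A) n = 2 * K + 2 := Nat.count_nth_of_infinite (p := (· ∈ A)) hA _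
  have hle : rank (step A d) n ≤ K := Set.ncard_le_ncard (fun _ hm => hm.1) hfin
  have hmono : Nat.count (· ∈ A) n ≤ rank A n := by
    rw [rank_eq_count]
    exact Nat.count_monotone _ n.le_succ
  have hadd := rank_step_add A d n
  have hdiv : rank A n / d ≤ rank A n / 2 := Nat.div_le_div_left hd two_pos
  omega

theorem A_succ (i : ℕ) : A (i + 1) = step (A i) (l (i + 1)) := rfl

theorem l_succ (i : ℕ) : l (i + 1) = sInf {m | m ∈ A i ∧ l i < m} := rfl

theorem l_lt_succ_of_infinite {i : ℕ} (hA : (A i).Infinite) : l i < l (i + 1) := by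
  rw [l_succ]
  obtain ⟨n, hn, hln⟩ := hA.exists_gt (l i)
  exact (Nat.sInf_mem (s := {m | m ∈ A i ∧ l i < m}) ⟨n, hn, hln⟩).2

theorem infinite_A_and_one_le_l (i : ℕ) : (A i).Infinite ∧ 1 ≤ l i := by
  induction i with
  | zero => exact ⟨Set.Ici_infinite 1, le_rfl⟩
  | succ i ih =>
    have hl := l_lt_succ_of_infinite ih.1
    have hd : 2 ≤ l (i + 1) := by omega
    exact ⟨infinite_step ih.1 hd, by omega⟩

theorem l_strictMono : StrictMono l :=
  strictMono_nat_of_lt_succ fun i => l_lt_succ_of_infinite (infinite_A_and_one_le_l i).1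

theorem A_antitone : Antitone A := antitone_nat_of_succ_le fun _ _ hk => hk.1

theorem R_succ_eq_rank (i : ℕ) {x : ℝ} (hx : 0 ≤ x) : R (i + 1) x = rank (A i) ⌊x⌋₊ := by
  simp [R, rank, Nat.le_floor_iff hx]

theorem mem_A_of_rank_lt {m k n : ℕ} (h : rank (A m) n < l (m + 1)) (hkn : k ≤ n)
    (hk : k ∈ A m) {j : ℕ} (hj : m ≤ j) : k ∈ A j := by
  induction j, hj using Nat.le_induction with
  | base => exact hk
  | succ j hj ih =>
    refine ⟨ih, Nat.not_dvd_of_pos_of_lt (rank_pos ih) ?_⟩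
    calc rank (A j) k ≤ rank (A m) n := rank_le_rank_of_subset (A_antitone hj) hkn
      _ < l (m + 1) := h
      _ ≤ l (j + 1) := l_strictMono.monotone (by omega)

theorem L_eq_rank {x : ℝ} (hx : 0 ≤ x) {m : ℕ} (h : rank (A m) ⌊x⌋₊ < l (m + 1)) :
    L x = rank (A m) ⌊x⌋₊ := by
  rw [L, rank]
  congr 1
  ext k
  simp only [Set.mem_ofPred_eq, ← Nat.le_floor_iff hx, LuckySet, Set.mem_iInter]
  refine and_congr_left fun hk => ⟨fun hA => hA m, fun hA j => ?_⟩
  rcases le_total m j with hj | hj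
  · exact mem_A_of_rank_lt h hk hA hj
  · exact A_antitone hj hA

theorem rank_A_zero (n : ℕ) : rank (A 0) n = n := by
  have : {m | m ∈ A 0 ∧ m ≤ n} = (Finset.Icc 1 n : Set ℕ) := by
    ext m
    simp [A, sieve]
  rw [rank, this, Set.ncard_coe_finset, Nat.card_Icc, Nat.add_sub_cancel]

/-- One sieve step multiplies the count by `1 - 1 / l (i + 1)`, up to an error in `[0, 1)`. -/
theorem rank_A_succ_bounds (n i : ℕ) :
    (rank (A i) n : ℝ) * (1 - 1 / (l (i + 1) : ℝ)) ≤ rank (A (i + 1)) n ∧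
    (rank (A (i + 1)) n : ℝ) < rank (A i) n * (1 - 1 / (l (i + 1) : ℝ)) + 1 := by
  have hl : (0 : ℝ) < l (i + 1) := by exact_mod_cast (infinite_A_and_one_le_l (i + 1)).2
  have hadd : (rank (A (i + 1)) n : ℝ) + (rank (A i) n / l (i + 1) : ℕ) = rank (A i) n := by
    exact_mod_cast rank_step_add (A i) (l (i + 1)) n
  have hle : ((rank (A i) n / l (i + 1) : ℕ) : ℝ) ≤ rank (A i) n / l (i + 1) := Nat.cast_div_le
  have hlt : (rank (A i) n : ℝ) / l (i + 1) < (rank (A i) n / l (i + 1) : ℕ) + 1 := by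
    rw [div_lt_iff₀ hl]
    exact_mod_cast Nat.lt_mul_of_div_lt (Nat.lt_succ_self _)
      (infinite_A_and_one_le_l (i + 1)).2
  rw [mul_sub, mul_one, mul_one_div]
  constructor <;> linarith

theorem one_sub_inv_l_mem_Icc (i : ℕ) : 1 - 1 / (l i : ℝ) ∈ Set.Icc (0 : ℝ) 1 := by
  have hl : (1 : ℝ) ≤ l i := by exact_mod_cast (infinite_A_and_one_le_l i).2
  have hle : 1 / (l i : ℝ) ≤ 1 := by rwa [div_le_one (by linarith)]
  have hpos : 0 ≤ 1 / (l i : ℝ) := by positivity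
  constructor <;> linarith

theorem mul_prod_le_rank_A (n m : ℕ) :
    (n : ℝ) * ∏ i ∈ Finset.Icc 1 m, (1 - 1 / (l i : ℝ)) ≤ rank (A m) n := by
  induction m with
  | zero => simp [rank_A_zero]
  | succ m ih =>
    rw [Finset.prod_Icc_succ_top (by omega), ← mul_assoc]
    exact (mul_le_mul_of_nonneg_right ih (one_sub_inv_l_mem_Icc _).1).trans
      (rank_A_succ_bounds n m).1

theorem rank_A_succ_lt_of_le {n m : ℕ}
    (h : (rank (A m) n : ℝ) ≤ n * ∏ i ∈ Finset.Icc 1 m, (1 - 1 / (l i : ℝ)) + m) :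
    (rank (A (m + 1)) n : ℝ) <
      n * ∏ i ∈ Finset.Icc 1 (m + 1), (1 - 1 / (l i : ℝ)) + (m + 1 : ℕ) := by
  obtain ⟨h₀, h₁⟩ := one_sub_inv_l_mem_Icc (m + 1)
  have hstep := (rank_A_succ_bounds n m).2
  rw [Finset.prod_Icc_succ_top (by omega), ← mul_assoc]
  have hmul := mul_le_mul_of_nonneg_right h h₀
  rw [add_mul] at hmul
  have herr := mul_le_of_le_one_right (Nat.cast_nonneg (α := ℝ) m) h₁
  push_cast at *
  linarith

theorem rank_A_le_mul_prod_add (n m : ℕ) :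
    (rank (A m) n : ℝ) ≤ n * ∏ i ∈ Finset.Icc 1 m, (1 - 1 / (l i : ℝ)) + m := by
  induction m with
  | zero => simp [rank_A_zero]
  | succ m ih => exact (rank_A_succ_lt_of_le ih).le

/-- bounds for the lucky counting function: for real `x ≥ 1` and every
`m ≥ 1` with `l_{m+1} > R(m+1,x)`, one has
`⌊x⌋·∏_{i=1}^{m}(1 − 1/l_i) ≤ L(x) < ⌊x⌋·∏_{i=1}^{m}(1 − 1/l_i) + m`. -/
theorem count_product_bounds (x : ℝ) (hx : 1 ≤ x) (m : ℕ) (hm : 1 ≤ m)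
    (h : R (m + 1) x < l (m + 1)) :
    (⌊x⌋ : ℝ) * ∏ i ∈ Finset.Icc 1 m, (1 - 1 / (l i : ℝ)) ≤ (L x : ℝ) ∧
    (L x : ℝ) < (⌊x⌋ : ℝ) * ∏ i ∈ Finset.Icc 1 m, (1 - 1 / (l i : ℝ)) + m := by
  have hx₀ : 0 ≤ x := by linarith
  rw [R_succ_eq_rank m hx₀] at h
  rw [L_eq_rank hx₀ h, ← natCast_floor_eq_intCast_floor hx₀]
  refine ⟨mul_prod_le_rank_A _ m, ?_⟩
  obtain ⟨k, rfl⟩ := Nat.exists_eq_add_of_le' hm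
  exact rank_A_succ_lt_of_le (rank_A_le_mul_prod_add _ k)

end LuckyPaper
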